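/- arXiv:2212.05220 — 5 statements merged into one kernel-verified Lean document; each statement's English description precedes it below -/
import Mathlib

section
/- Let R be a commutative Noetherian local ring and let 𝒳 be a class of finitely generated R-modules that is closed under isomorphisms and closed under extensions (i.e., for any short exact sequence 0 → N → L → M → 0 of finitely generated R-modules, if M and N belong to 𝒳 then so does L). Suppose there is a short exact sequence 0 → M → K → N → 0 of finitely generated R-modules with N ∈ 𝒳, and suppose K ∈ Ω𝒳, i.e., there is a short exact sequence 0 → K → F → K′ → 0 with F finitely generated free and K′ ∈ 𝒳. Then M ∈ Ω𝒳; more precisely, there exists C ∈ 𝒳 and a short exact sequence 0 → M → F → C → 0 with the same free module F. -/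
universe u

namespace LinearMap

variable {R M K N F K' : Type*} [CommRing R] [AddCommGroup M] [AddCommGroup K] [AddCommGroup N]
  [AddCommGroup F] [AddCommGroup K'] [Module R M] [Module R K] [Module R N] [Module R F]
  [Module R K']

/-- For `0 → M → K → N → 0` exact and an embedding `ι : K → F`, with cokernel `π : F → K'`, there
is an exact sequence `0 → N → F / M → K' → 0`. -/
theorem exists_exact_quotient_range_comp {f : M →ₗ[R] K} {g : K →ₗ[R] N} {ι : K →ₗ[R] F}
    {π : F →ₗ[R] K'} (hfg : Function.Exact f g) (hg : Function.Surjective g)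
    (hι : Function.Injective ι) (hιπ : Function.Exact ι π) (hπ : Function.Surjective π) :
    ∃ (a : N →ₗ[R] F ⧸ range (ι ∘ₗ f)) (b : F ⧸ range (ι ∘ₗ f) →ₗ[R] K'),
      Function.Injective a ∧ Function.Exact a b ∧ Function.Surjective b := by
  set P := range (ι ∘ₗ f)
  have hker : ker g ≤ ker (P.mkQ ∘ₗ ι) := by
    intro k hk
    obtain ⟨m, rfl⟩ := (hfg k).1 hk
    exact (Submodule.Quotient.mk_eq_zero P).2 ⟨m, rfl⟩
  have hP : P ≤ ker π := by
    rintro _ ⟨m, rfl⟩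
    exact hιπ.apply_apply_eq_zero (f m)
  let a : N →ₗ[R] F ⧸ P :=
    (ker g).liftQ (P.mkQ ∘ₗ ι) hker ∘ₗ (g.quotKerEquivOfSurjective hg).symm.toLinearMap
  have ha (k : K) : a (g k) = P.mkQ (ι k) := by
    have h : (g.quotKerEquivOfSurjective hg).symm (g k) = (ker g).mkQ k := by
      rw [LinearEquiv.symm_apply_eq]
      rfl
    simp [a, h]
  refine ⟨a, P.liftQ π hP, ?_, ?_, ?_⟩
  · rw [injective_iff_map_eq_zero]
    intro n hn
    obtain ⟨k, rfl⟩ := hg n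
    rw [ha] at hn
    obtain ⟨m, hm⟩ := (Submodule.Quotient.mk_eq_zero P).1 hn
    exact (hfg k).2 ⟨m, hι hm⟩
  · intro c
    obtain ⟨x, rfl⟩ := P.mkQ_surjective c
    constructor
    · intro hx
      obtain ⟨k, rfl⟩ := (hιπ x).1 hx
      exact ⟨g k, ha k⟩
    · rintro ⟨n, hn⟩
      obtain ⟨k, rfl⟩ := hg n
      rw [← hn, ha]
      exact hιπ.apply_apply_eq_zero k
  · intro y
    obtain ⟨x, rfl⟩ := hπ y
    exact ⟨P.mkQ x, rfl⟩

end LinearMap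

/-- Let `R` be a commutative Noetherian local ring and let `𝒳` be a class of
finitely generated `R`-modules closed under isomorphisms and under extensions.  Suppose there is
a short exact sequence `0 → M → K → N → 0` of finitely generated `R`-modules with `N ∈ 𝒳`, and
a short exact sequence `0 → K → F → K' → 0` with `F` finitely generated free and `K' ∈ 𝒳`
(so `K ∈ Ω𝒳`).  Then there exists `C ∈ 𝒳` and a short exact sequence `0 → M → F → C → 0`,
with the same free module `F`; in particular `M ∈ Ω𝒳`. -/
theorem stmt2
    {R : Type u} [CommRing R] [IsNoetherianRing R] [IsLocalRing R]
    (𝒳 : Set (ModuleCat.{u} R))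
    (h𝒳fg : ∀ M ∈ 𝒳, Module.Finite R M)
    (h𝒳iso : ∀ M N : ModuleCat.{u} R, (↥M ≃ₗ[R] ↥N) → M ∈ 𝒳 → N ∈ 𝒳)
    (h𝒳ext : ∀ (N L M : ModuleCat.{u} R),
      Module.Finite R N → Module.Finite R L → Module.Finite R M →
      ∀ (f : ↥N →ₗ[R] ↥L) (g : ↥L →ₗ[R] ↥M),
        Function.Injective f → Function.Exact f g → Function.Surjective g →
        M ∈ 𝒳 → N ∈ 𝒳 → L ∈ 𝒳)
    (M K N F K' : ModuleCat.{u} R)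
    (hMfg : Module.Finite R M) (hKfg : Module.Finite R K) (hNfg : Module.Finite R N)
    (hFfg : Module.Finite R F) (hK'fg : Module.Finite R K')
    (hFfree : Module.Free R F)
    (hN : N ∈ 𝒳) (hK' : K' ∈ 𝒳)
    (f : ↥M →ₗ[R] ↥K) (g : ↥K →ₗ[R] ↥N)
    (hf : Function.Injective f) (hfg : Function.Exact f g) (hg : Function.Surjective g)
    (ι : ↥K →ₗ[R] ↥F) (π : ↥F →ₗ[R] ↥K')
    (hι : Function.Injective ι) (hιπ : Function.Exact ι π) (hπ : Function.Surjective π) :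
    ∃ C : ModuleCat.{u} R, C ∈ 𝒳 ∧
      ∃ (j : ↥M →ₗ[R] ↥F) (q : ↥F →ₗ[R] ↥C),
        Function.Injective j ∧ Function.Exact j q ∧ Function.Surjective q := by
  obtain ⟨a, b, ha, hab, hb⟩ :=
    LinearMap.exists_exact_quotient_range_comp hfg hg hι hιπ hπ
  refine ⟨ModuleCat.of R (↥F ⧸ LinearMap.range (ι ∘ₗ f)), ?_, ι ∘ₗ f, Submodule.mkQ _,
    hι.comp hf, LinearMap.exact_map_mkQ_range _, Submodule.mkQ_surjective _⟩
  exact h𝒳ext N (ModuleCat.of R (↥F ⧸ LinearMap.range (ι ∘ₗ f))) K' hNfg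
    (inferInstanceAs (Module.Finite R (↥F ⧸ LinearMap.range (ι ∘ₗ f)))) hK'fg
    a b ha hab hb hK' hN
end

section
/- Let R be a commutative Noetherian local ring and let 𝒳 be a resolving subcategory of the category of finitely generated R-modules. Then Ω𝒳 is additive: Ω𝒳 is closed under finite direct sums, and if M and N are finitely generated R-modules with M ⊕ N ∈ Ω𝒳, then M ∈ Ω𝒳 (and N ∈ Ω𝒳). -/
universe u

open Function

variable {R : Type u} [CommRing R]

/-- `M` belongs to `Ω𝒳`: there is a short exact sequence `0 → M → F → N → 0`
with `F` finitely generated free and `N ∈ 𝒳`. -/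
def MemSyzygy (𝒳 : Set (ModuleCat.{u} R)) (M : ModuleCat.{u} R) : Prop :=
  ∃ F N : ModuleCat.{u} R, Module.Finite R F ∧ Module.Free R F ∧ N ∈ 𝒳 ∧
    ∃ (i : ↥M →ₗ[R] ↥F) (p : ↥F →ₗ[R] ↥N),
      Function.Injective i ∧ Function.Exact i p ∧ Function.Surjective p

/-- A class of modules containing `R` and closed under isomorphisms, binary direct sums and direct
summands contains every finitely generated free module. -/
theorem mem_of_finite_free (𝒳 : Set (ModuleCat.{u} R))
    (hiso : ∀ M N : ModuleCat.{u} R, (↥M ≃ₗ[R] ↥N) → M ∈ 𝒳 → N ∈ 𝒳)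
    (hR : ModuleCat.of R R ∈ 𝒳)
    (hsum : ∀ M N : ModuleCat.{u} R, M ∈ 𝒳 → N ∈ 𝒳 → ModuleCat.of R (↥M × ↥N) ∈ 𝒳)
    (hsummand : ∀ M N : ModuleCat.{u} R, ModuleCat.of R (↥M × ↥N) ∈ 𝒳 → M ∈ 𝒳)
    (F : ModuleCat.{u} R) [Module.Finite R F] [Module.Free R F] : F ∈ 𝒳 := by
  have hpi (n : ℕ) : ModuleCat.of R (Fin n → R) ∈ 𝒳 := by
    induction n with
    | zero =>
      exact hsummand _ (ModuleCat.of R R) (hiso (ModuleCat.of R R)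
        (ModuleCat.of R ((Fin 0 → R) × R)) LinearEquiv.uniqueProd.symm hR)
    | succ n ih =>
      exact hiso (ModuleCat.of R (R × (Fin n → R))) (ModuleCat.of R (Fin (n + 1) → R))
        (Fin.consLinearEquiv R fun _ => R) (hsum _ _ hR ih)
  let b := (Module.Free.chooseBasis R F).reindex (Fintype.equivFin _)
  exact hiso (ModuleCat.of R (Fin _ → R)) F b.equivFun.symm (hpi _)

/-- If `M` embeds in a finitely generated free module `F` with cokernel in `𝒳`, then
`M ∈ Ω𝒳`. -/
theorem memSyzygy_of_quotient_range {𝒳 : Set (ModuleCat.{u} R)} {M F : ModuleCat.{u} R}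
    [Module.Finite R F] [Module.Free R F] (i : ↥M →ₗ[R] ↥F) (hi : Injective i)
    (h : ModuleCat.of R (↥F ⧸ i.range) ∈ 𝒳) : MemSyzygy 𝒳 M :=
  ⟨F, _, inferInstance, inferInstance, h, i, i.range.mkQ, hi,
    LinearMap.exact_map_mkQ_range i, Submodule.mkQ_surjective _⟩

/-- Direct sums of syzygies of modules in `𝒳` are syzygies of modules in `𝒳`. -/
theorem MemSyzygy.prod {𝒳 : Set (ModuleCat.{u} R)}
    (hsum : ∀ M N : ModuleCat.{u} R, M ∈ 𝒳 → N ∈ 𝒳 → ModuleCat.of R (↥M × ↥N) ∈ 𝒳)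
    {M N : ModuleCat.{u} R} (hM : MemSyzygy 𝒳 M) (hN : MemSyzygy 𝒳 N) :
    MemSyzygy 𝒳 (ModuleCat.of R (↥M × ↥N)) := by
  obtain ⟨F, X, _, _, hX, i, p, hi, hip, hp⟩ := hM
  obtain ⟨G, Y, _, _, hY, j, q, hj, hjq, hq⟩ := hN
  refine ⟨ModuleCat.of R (F × G), ModuleCat.of R (X × Y),
    inferInstanceAs (Module.Finite R (F × G)), inferInstanceAs (Module.Free R (F × G)),
    hsum _ _ hX hY, i.prodMap j, p.prodMap q, hi.prodMap hj, ?_, hp.prodMap hq⟩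
  rintro ⟨x, y⟩
  simp [Prod.ext_iff, hip x, hjq y]

/-- For submodules `P`, `Q` of `F` with `P ⊓ Q = ⊥` and a surjection `p : F → X` with kernel
`P ⊔ Q`, the sequence `0 → F → F ⧸ P × F ⧸ Q → X → 0` is exact. -/
theorem Submodule.exists_exact_prod_quotient {F X : Type*} [AddCommGroup F] [Module R F]
    [AddCommGroup X] [Module R X] (P Q : Submodule R F) (hPQ : P ⊓ Q = ⊥) (p : F →ₗ[R] X)
    (hker : p.ker = P ⊔ Q) (hp : Surjective p) :
    ∃ (f : F →ₗ[R] (F ⧸ P) × (F ⧸ Q)) (g : (F ⧸ P) × (F ⧸ Q) →ₗ[R] X),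
      Injective f ∧ Exact f g ∧ Surjective g := by
  have hP : P ≤ p.ker := hker ▸ le_sup_left
  have hQ : Q ≤ p.ker := hker ▸ le_sup_right
  refine ⟨P.mkQ.prod Q.mkQ, (P.liftQ p hP).coprod (-Q.liftQ p hQ), ?_, ?_, ?_⟩
  · rw [← LinearMap.ker_eq_bot, LinearMap.ker_prod, P.ker_mkQ, Q.ker_mkQ, hPQ]
  · rintro ⟨a, b⟩
    obtain ⟨a, rfl⟩ := P.mkQ_surjective a
    obtain ⟨b, rfl⟩ := Q.mkQ_surjective b
    constructor
    · intro h
      have hab : a - b ∈ P ⊔ Q := by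
        rw [← hker, LinearMap.mem_ker, map_sub, sub_eq_add_neg]
        simpa using h
      obtain ⟨x, hx, y, hy, hxy⟩ := Submodule.mem_sup.mp hab
      refine ⟨a - x, Prod.ext ?_ ?_⟩
      · exact (Submodule.Quotient.eq P).mpr (by simpa using hx)
      · refine (Submodule.Quotient.eq Q).mpr ?_
        have : a - x - b = y := by rw [sub_right_comm, ← hxy, add_sub_cancel_left]
        rwa [this]
    · rintro ⟨c, hc⟩
      rw [← hc]
      simp
  · intro x
    obtain ⟨y, rfl⟩ := hp x
    exact ⟨(P.mkQ y, 0), by simp⟩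

/-- Let `R` be a commutative Noetherian local ring and `𝒳` a resolving
subcategory of the category of finitely generated `R`-modules.  Then `Ω𝒳` is additive:
it is closed under finite direct sums, and if `M ⊕ N ∈ Ω𝒳` then `M ∈ Ω𝒳` and `N ∈ Ω𝒳`. -/
theorem stmt3 [IsNoetherianRing R] [IsLocalRing R]
    (𝒳 : Set (ModuleCat.{u} R))
    (h𝒳fg : ∀ M ∈ 𝒳, Module.Finite R M)
    (h𝒳iso : ∀ M N : ModuleCat.{u} R, (↥M ≃ₗ[R] ↥N) → M ∈ 𝒳 → N ∈ 𝒳)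
    (h𝒳R : ModuleCat.of R R ∈ 𝒳)
    (h𝒳sum : ∀ M N : ModuleCat.{u} R, M ∈ 𝒳 → N ∈ 𝒳 → ModuleCat.of R (↥M × ↥N) ∈ 𝒳)
    (h𝒳summand : ∀ M N : ModuleCat.{u} R, ModuleCat.of R (↥M × ↥N) ∈ 𝒳 → M ∈ 𝒳)
    (h𝒳ext : ∀ (N L M : ModuleCat.{u} R),
      Module.Finite R N → Module.Finite R L → Module.Finite R M →
      ∀ (f : ↥N →ₗ[R] ↥L) (g : ↥L →ₗ[R] ↥M),
        Function.Injective f → Function.Exact f g → Function.Surjective g →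
        M ∈ 𝒳 → N ∈ 𝒳 → L ∈ 𝒳)
    (h𝒳ker : ∀ (N L M : ModuleCat.{u} R),
      Module.Finite R N → Module.Finite R L → Module.Finite R M →
      ∀ (f : ↥N →ₗ[R] ↥L) (g : ↥L →ₗ[R] ↥M),
        Function.Injective f → Function.Exact f g → Function.Surjective g →
        L ∈ 𝒳 → M ∈ 𝒳 → N ∈ 𝒳) :
    (∀ M N : ModuleCat.{u} R, Module.Finite R M → Module.Finite R N →
      MemSyzygy 𝒳 M → MemSyzygy 𝒳 N → MemSyzygy 𝒳 (ModuleCat.of R (↥M × ↥N))) ∧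
    (∀ M N : ModuleCat.{u} R, Module.Finite R M → Module.Finite R N →
      MemSyzygy 𝒳 (ModuleCat.of R (↥M × ↥N)) → MemSyzygy 𝒳 M ∧ MemSyzygy 𝒳 N) := by
  refine ⟨fun M N _ _ hM hN => hM.prod h𝒳sum hN, fun M N _ _ h => ?_⟩
  obtain ⟨F, X, _, _, hX, i, p, hi, hip, hp⟩ := h
  have : Module.Finite R X := h𝒳fg X hX
  let i₁ : ↥M →ₗ[R] ↥F := i ∘ₗ LinearMap.inl R M N
  let i₂ : ↥N →ₗ[R] ↥F := i ∘ₗ LinearMap.inr R M N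
  have hinf : i₁.range ⊓ i₂.range = ⊥ := by
    rw [LinearMap.range_comp, LinearMap.range_comp, ← Submodule.map_inf i hi,
      LinearMap.disjoint_inl_inr.eq_bot, Submodule.map_bot]
  have hker : p.ker = i₁.range ⊔ i₂.range := by
    rw [LinearMap.range_comp, LinearMap.range_comp, ← Submodule.map_sup,
      LinearMap.sup_range_inl_inr, Submodule.map_top]
    exact hip.linearMap_ker_eq
  obtain ⟨f, g, hf, hfg, hg⟩ :=
    Submodule.exists_exact_prod_quotient i₁.range i₂.range hinf p hker hp
  have hF : F ∈ 𝒳 := mem_of_finite_free 𝒳 h𝒳iso h𝒳R h𝒳sum h𝒳summand F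
  have hprod : ModuleCat.of R ((↥F ⧸ i₁.range) × (↥F ⧸ i₂.range)) ∈ 𝒳 :=
    h𝒳ext F _ X inferInstance
      (inferInstanceAs (Module.Finite R ((↥F ⧸ i₁.range) × (↥F ⧸ i₂.range))))
      inferInstance f g hf hfg hg hX hF
  have hprod' : ModuleCat.of R ((↥F ⧸ i₂.range) × (↥F ⧸ i₁.range)) ∈ 𝒳 :=
    h𝒳iso (ModuleCat.of R ((↥F ⧸ i₁.range) × (↥F ⧸ i₂.range))) _
      (LinearEquiv.prodComm R (↥F ⧸ i₁.range) (↥F ⧸ i₂.range)) hprod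
  exact ⟨memSyzygy_of_quotient_range i₁ (hi.comp LinearMap.inl_injective)
      (h𝒳summand _ (ModuleCat.of R (↥F ⧸ i₂.range)) hprod),
    memSyzygy_of_quotient_range i₂ (hi.comp LinearMap.inr_injective)
      (h𝒳summand _ (ModuleCat.of R (↥F ⧸ i₁.range)) hprod')⟩
end

section
/- Let c ≥ 1 be an integer, let f(t) be a real polynomial of degree c − 1 with positive leading coefficient, and let u be a real number with 0 < u ≤ 1. Define the sequence a_n = Σ_{l=0}^{n} u^{n−l} f(l) for n ≥ 0. Then the sequence (a_n) has polynomial growth of degree c. Furthermore, if u < 1, then (a_n) has polynomial growth of degree c − 1. -/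
open Filter

/-- A sequence `a : ℕ → ℝ` has polynomial growth of degree `d` if it is eventually
nonnegative and there is a real `A > 0` with `a n ≤ A * n ^ d` for all large `n`. -/
def HasPolynomialGrowth (a : ℕ → ℝ) (d : ℕ) : Prop :=
  (∀ᶠ n in atTop, 0 ≤ a n) ∧ ∃ A : ℝ, 0 < A ∧ ∀ᶠ n in atTop, a n ≤ A * (n : ℝ) ^ d

open Polynomial in
/-- A real polynomial with positive leading coefficient is eventually bounded below by a
positive constant along the natural numbers. -/
theorem exists_pos_eventually_le_eval_natCast {f : ℝ[X]} (hlead : 0 < f.leadingCoeff) :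
    ∃ δ : ℝ, 0 < δ ∧ ∀ᶠ n : ℕ in atTop, δ ≤ f.eval (n : ℝ) := by
  rcases Nat.eq_zero_or_pos f.natDegree with h | h
  · refine ⟨f.leadingCoeff, hlead, Eventually.of_forall fun n => ?_⟩
    rw [eq_C_of_natDegree_eq_zero h]
    simp
  · refine ⟨1, one_pos, ?_⟩
    have ht := f.tendsto_atTop_of_leadingCoeff_nonneg (natDegree_pos_iff_degree_pos.mp h) hlead.le
    exact (ht.comp tendsto_natCast_atTop_atTop).eventually_ge_atTop 1

open Polynomial in
/-- A nonzero real polynomial is bounded on `{0, …, n}` by a multiple of `n ^ natDegree`. -/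
theorem exists_pos_eval_natCast_le {f : ℝ[X]} (hf : f ≠ 0) :
    ∃ B : ℝ, 0 < B ∧ ∀ n l : ℕ, 1 ≤ n → l ≤ n → f.eval (l : ℝ) ≤ B * (n : ℝ) ^ f.natDegree := by
  refine ⟨∑ i ∈ Finset.range (f.natDegree + 1), |f.coeff i|, ?_, fun n l hn hl => ?_⟩
  · refine Finset.sum_pos' (fun i _ => abs_nonneg _) ⟨f.natDegree, by simp, ?_⟩
    exact abs_pos.mpr (leadingCoeff_ne_zero.mpr hf)
  · rw [eval_eq_sum_range, Finset.sum_mul]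
    refine Finset.sum_le_sum fun i hi => ?_
    have hn' : (1 : ℝ) ≤ n := by exact_mod_cast hn
    have hl' : (l : ℝ) ≤ n := by exact_mod_cast hl
    have hi' : i ≤ f.natDegree := Nat.lt_succ_iff.mp (Finset.mem_range.mp hi)
    calc f.coeff i * (l : ℝ) ^ i ≤ |f.coeff i| * (l : ℝ) ^ i := by gcongr; exact le_abs_self _
      _ ≤ |f.coeff i| * (n : ℝ) ^ i := by gcongr
      _ ≤ |f.coeff i| * (n : ℝ) ^ f.natDegree := by gcongr

/-- A solution of `a (n + 1) = u * a n + g (n + 1)` with `0 ≤ u ≤ 1` is eventually nonnegative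
if `g` is eventually bounded below by a positive constant. -/
theorem eventually_nonneg_of_recurrence {a g : ℕ → ℝ} {u δ : ℝ} (hu0 : 0 ≤ u) (hu1 : u ≤ 1)
    (hδ : 0 < δ) (hg : ∀ᶠ n in atTop, δ ≤ g n) (ha : ∀ n, a (n + 1) = u * a n + g (n + 1)) :
    ∀ᶠ n in atTop, 0 ≤ a n := by
  obtain ⟨N, hN⟩ := eventually_atTop.mp hg
  obtain ⟨m, hNm, hm⟩ : ∃ m, N ≤ m ∧ 0 ≤ a m := by
    by_contra! hneg
    have hgrow : ∀ k : ℕ, a N + k * δ ≤ a (N + k) := by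
      intro k
      induction k with
      | zero => simp
      | succ k ih =>
        have h1 := hneg (N + k) (by omega)
        have h2 := hN (N + k + 1) (by omega)
        rw [← add_assoc, ha]
        push_cast
        nlinarith
    obtain ⟨k, hk⟩ := Archimedean.arch (-a N) hδ
    rw [nsmul_eq_mul] at hk
    linarith [hgrow k, hneg (N + k) (by omega)]
  refine eventually_atTop.mpr ⟨m, fun n hn => ?_⟩
  induction n, hn using Nat.le_induction with
  | base => exact hm
  | succ n hn ih =>
    rw [ha]
    have h := hN (n + 1) (by omega)
    have h' := mul_nonneg hu0 ih
    linarith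

/-- Let `c ≥ 1`, let `f` be a real polynomial of degree `c - 1` with positive
leading coefficient, and let `0 < u ≤ 1`.  Define `a n = ∑_{l=0}^{n} u ^ (n - l) * f(l)`.
Then `(a n)` has polynomial growth of degree `c`; furthermore, if `u < 1`, then `(a n)` has
polynomial growth of degree `c - 1`. -/
theorem stmt4 (c : ℕ) (hc : 1 ≤ c) (f : Polynomial ℝ)
    (hdeg : f.natDegree = c - 1) (hlead : 0 < f.leadingCoeff)
    (u : ℝ) (hu0 : 0 < u) (hu1 : u ≤ 1)
    (a : ℕ → ℝ)
    (ha : ∀ n, a n = ∑ l ∈ Finset.range (n + 1), u ^ (n - l) * f.eval (l : ℝ)) :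
    HasPolynomialGrowth a c ∧ (u < 1 → HasPolynomialGrowth a (c - 1)) := by
  obtain ⟨δ, hδ, hfδ⟩ := exists_pos_eventually_le_eval_natCast hlead
  obtain ⟨B, hB, hfB⟩ :=
    exists_pos_eval_natCast_le (Polynomial.leadingCoeff_ne_zero.mp hlead.ne')
  rw [hdeg] at hfB
  have hrec : ∀ n, a (n + 1) = u * a n + f.eval ((n + 1 : ℕ) : ℝ) := by
    intro n
    rw [ha, ha, Finset.sum_range_succ, Nat.sub_self, pow_zero, one_mul, Finset.mul_sum]
    congr 1
    refine Finset.sum_congr rfl fun l hl => ?_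
    rw [Nat.sub_add_comm (Nat.lt_succ_iff.mp (Finset.mem_range.mp hl)), pow_succ']
    ring
  have hnonneg : ∀ᶠ n in atTop, 0 ≤ a n :=
    eventually_nonneg_of_recurrence (g := fun n => f.eval (n : ℝ)) hu0.le hu1 hδ hfδ hrec
  have hbound : ∀ n, 1 ≤ n →
      a n ≤ (∑ l ∈ Finset.range (n + 1), u ^ l) * (B * (n : ℝ) ^ (c - 1)) := by
    intro n hn
    rw [ha, ← Finset.sum_range_reflect (fun l => u ^ l), Finset.sum_mul]
    refine Finset.sum_le_sum fun l hl => ?_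
    rw [Nat.add_sub_cancel]
    exact mul_le_mul_of_nonneg_left
      (hfB n l hn (Nat.lt_succ_iff.mp (Finset.mem_range.mp hl))) (by positivity)
  refine ⟨⟨hnonneg, 2 * B, by positivity, ?_⟩, fun hu => ⟨hnonneg, (1 - u)⁻¹ * B, ?_, ?_⟩⟩
  · filter_upwards [eventually_ge_atTop 1] with n hn
    have hn' : (1 : ℝ) ≤ n := by exact_mod_cast hn
    have hsum : ∑ l ∈ Finset.range (n + 1), u ^ l ≤ 2 * n := by
      calc ∑ l ∈ Finset.range (n + 1), u ^ l ≤ ∑ _l ∈ Finset.range (n + 1), (1 : ℝ) :=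
            Finset.sum_le_sum fun l _ => pow_le_one₀ hu0.le hu1
        _ = n + 1 := by simp
        _ ≤ 2 * n := by linarith
    calc a n ≤ _ := hbound n hn
      _ ≤ 2 * n * (B * (n : ℝ) ^ (c - 1)) := by gcongr
      _ = 2 * B * (n : ℝ) ^ (c - 1 + 1) := by ring
      _ = 2 * B * (n : ℝ) ^ c := by rw [Nat.sub_add_cancel hc]
  · exact mul_pos (inv_pos.mpr (sub_pos.mpr hu)) hB
  · filter_upwards [eventually_ge_atTop 1] with n hn
    have hsum : ∑ l ∈ Finset.range (n + 1), u ^ l ≤ (1 - u)⁻¹ := by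
      rw [← tsum_geometric_of_lt_one hu0.le hu]
      exact (summable_geometric_of_lt_one hu0.le hu).sum_le_tsum _ fun l _ => by positivity
    calc a n ≤ _ := hbound n hn
      _ ≤ (1 - u)⁻¹ * (B * (n : ℝ) ^ (c - 1)) := by gcongr
      _ = (1 - u)⁻¹ * B * (n : ℝ) ^ (c - 1) := by ring
end

section
/- Let a, b ≥ 1 be integers with a ≤ b, let n ≥ 0 and c ≥ 1 be integers, let A > 0 be a real number, and let (β_i)_{i ≥ 0} be a sequence of nonnegative real numbers satisfying b·β_{i+n+1} ≤ A·(i+1)^{c−1} + a·β_i for all i ≥ 1. Then the sequence (β_m) has polynomial growth of degree c, i.e., there exists A′ > 0 with β_m ≤ A′·m^{c} for all sufficiently large m. If moreover a < b, then (β_m) has polynomial growth of degree c − 1, i.e., there exists A″ > 0 with β_m ≤ A″·m^{c−1} for all sufficiently large m. -/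
open Filter

/-- A sequence satisfying the recursive inequality `b * β (i + n + 1) ≤ F i + a * β i` is bounded by
any `g` satisfying the reverse inequality, once this holds for the first `n + 1` indices. -/
theorem le_of_recursive_inequality {a b : ℝ} (ha : 0 ≤ a) (hb : 0 < b) {n : ℕ} {β g F : ℕ → ℝ}
    (hβ : ∀ i, 1 ≤ i → b * β (i + n + 1) ≤ F i + a * β i)
    (hg : ∀ i, 1 ≤ i → F i + a * g i ≤ b * g (i + n + 1))
    (hinit : ∀ m, 1 ≤ m → m ≤ n + 1 → β m ≤ g m) (m : ℕ) (hm : 1 ≤ m) : β m ≤ g m := by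
  induction m using Nat.strong_induction_on with
  | _ m ih =>
    rcases le_or_gt m (n + 1) with h | h
    · exact hinit m hm h
    · obtain ⟨i, rfl⟩ := Nat.exists_eq_add_of_lt h
      have hi := ih (i + 1) (by omega) (by omega)
      have h1 := hβ (i + 1) (by omega)
      have h2 := hg (i + 1) (by omega)
      rw [show n + 1 + i + 1 = i + 1 + n + 1 by omega]
      refine le_of_mul_le_mul_left ?_ hb
      linarith [mul_le_mul_of_nonneg_left hi ha]

/-- analytic content of parts (i) and (ii) of the paper's main technical
theorem.  Let `1 ≤ a ≤ b` be integers, `n ≥ 0` and `c ≥ 1` integers, `A > 0` real, and let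
`(β i)` be a sequence of nonnegative reals with
`b * β (i + n + 1) ≤ A * (i + 1) ^ (c - 1) + a * β i` for all `i ≥ 1`.  Then `(β m)` has
polynomial growth of degree `c`; and if moreover `a < b`, then `(β m)` has polynomial growth
of degree `c - 1`. -/
theorem stmt7 (a b : ℕ) (ha : 1 ≤ a) (hab : a ≤ b)
    (n c : ℕ) (hc : 1 ≤ c) (A : ℝ) (hA : 0 < A)
    (β : ℕ → ℝ) (hβ0 : ∀ i, 0 ≤ β i)
    (hrec : ∀ i : ℕ, 1 ≤ i →
      (b : ℝ) * β (i + n + 1) ≤ A * ((i : ℝ) + 1) ^ (c - 1) + (a : ℝ) * β i) :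
    (∃ A' : ℝ, 0 < A' ∧ ∀ᶠ m in atTop, β m ≤ A' * (m : ℝ) ^ c) ∧
    (a < b → ∃ A'' : ℝ, 0 < A'' ∧ ∀ᶠ m in atTop, β m ≤ A'' * (m : ℝ) ^ (c - 1)) := by
  have ha' : (0 : ℝ) ≤ a := a.cast_nonneg
  have hb' : (0 : ℝ) < b := by exact_mod_cast ha.trans hab
  have hb1 : (1 : ℝ) ≤ b := by exact_mod_cast ha.trans hab
  have hab' : (a : ℝ) ≤ b := by exact_mod_cast hab
  obtain ⟨d, rfl⟩ : ∃ d, c = d + 1 := ⟨c - 1, by omega⟩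
  rw [Nat.add_sub_cancel] at *
  set K : ℝ := A + ∑ m ∈ Finset.range (n + 2), β m
  have hAK : A ≤ K := le_add_of_nonneg_right (Finset.sum_nonneg fun i _ => hβ0 i)
  have hK0 : 0 < K := hA.trans_le hAK
  have hinit (e m : ℕ) (hm : 1 ≤ m) (hmn : m ≤ n + 1) : β m ≤ K * (m : ℝ) ^ e := by
    have h1 : β m ≤ K :=
      (Finset.single_le_sum (fun i _ => hβ0 i) (Finset.mem_range.2 (by omega))).trans
        (le_add_of_nonneg_left hA.le)
    exact h1.trans (le_mul_of_one_le_right hK0.le (one_le_pow₀ (by exact_mod_cast hm)))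
  have hforcing (i : ℕ) : A * ((i : ℝ) + 1) ^ d ≤ K * ((i : ℝ) + n + 1) ^ d := by
    gcongr
    exact le_add_of_nonneg_right n.cast_nonneg
  have hpow (i : ℕ) : (i : ℝ) ^ d ≤ ((i : ℝ) + n + 1) ^ d := by
    gcongr
    linarith [(n.cast_nonneg : (0 : ℝ) ≤ n)]
  refine ⟨⟨K, hK0, ?_⟩, fun hlt => ⟨K, hK0, ?_⟩⟩
  · filter_upwards [eventually_ge_atTop 1] with m hm
    refine le_of_recursive_inequality (g := fun m => K * (m : ℝ) ^ (d + 1)) ha' hb' hrec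
      (fun i _ => ?_) (hinit (d + 1)) m hm
    push_cast
    set P : ℝ := ((i : ℝ) + n + 1) ^ d with hP
    have hP0 : 0 ≤ P := by positivity
    calc A * ((i : ℝ) + 1) ^ d + a * (K * (i : ℝ) ^ (d + 1))
        ≤ K * P + b * (K * (P * i)) := by
          rw [pow_succ]
          gcongr ?_ + ?_ * (_ * (?_ * _))
          · exact hforcing i
          · exact hpow i
      _ ≤ b * (K * P) * (n + 1) + b * (K * (P * i)) := by
          gcongr ?_ + _
          have h1 : K * P ≤ b * (K * P) := le_mul_of_one_le_left (by positivity) hb1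
          exact h1.trans (le_mul_of_one_le_right (by positivity)
            (le_add_of_nonneg_left n.cast_nonneg))
      _ = b * (K * ((i : ℝ) + n + 1) ^ (d + 1)) := by rw [pow_succ, ← hP]; ring
  · have hlt' : (a : ℝ) + 1 ≤ b := by exact_mod_cast hlt
    filter_upwards [eventually_ge_atTop 1] with m hm
    refine le_of_recursive_inequality (g := fun m => K * (m : ℝ) ^ d) ha' hb' hrec
      (fun i _ => ?_) (hinit d) m hm
    push_cast
    calc A * ((i : ℝ) + 1) ^ d + a * (K * (i : ℝ) ^ d)
        ≤ K * ((i : ℝ) + n + 1) ^ d + a * (K * ((i : ℝ) + n + 1) ^ d) := by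
          gcongr ?_ + _ * (_ * ?_)
          · exact hforcing i
          · exact hpow i
      _ = (a + 1) * (K * ((i : ℝ) + n + 1) ^ d) := by ring
      _ ≤ b * (K * ((i : ℝ) + n + 1) ^ d) := by gcongr
end

section
/- Let a > b ≥ 1 be integers, set u = a/b (so u > 1), let n ≥ 0 and c ≥ 1 be integers, let A > 0 be a real number, and let (β_i)_{i ≥ 0} be a sequence of nonnegative real numbers satisfying a·β_i ≤ A·i^{c−1} + b·β_{i+n+1} for all i ≥ 1. Then: (1) the series C = Σ_{l=0}^{∞} u^{−l−1}·(1 + l(n+1))^{c−1} converges; (2) for all integers r, i ≥ 1 one has β_{i + r(n+1)} ≥ u^{r}·( β_i − (A·C/b)·i^{c−1} ); and (3) consequently, if there exist a real number B > 0 and an integer d ≥ 0 with β_i ≤ B·i^{d} for all i ≥ 1 (i.e., the sequence is polynomially bounded), then β_i ≤ (A·C/b)·i^{c−1} for all i ≥ 1. -/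
theorem summable_zpow_neg_mul_affine_pow {u q : ℝ} (hu : 1 < u) (hq : 0 ≤ q) (k : ℕ) :
    Summable (fun l : ℕ => u ^ (-(l : ℤ) - 1) * (1 + (l : ℝ) * q) ^ k) := by
  have hu0 : 0 < u := by linarith
  have hgeom := summable_pow_mul_geometric_of_norm_lt_one k (r := u⁻¹)
    (by rw [norm_inv, Real.norm_of_nonneg hu0.le]; exact inv_lt_one_of_one_lt₀ hu)
  refine Summable.of_nonneg_of_le (fun l => by positivity) (fun l => ?_)
    (((summable_nat_add_iff 1).2 hgeom).mul_left ((1 + q) ^ k))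
  have hzpow : u ^ (-(l : ℤ) - 1) = u⁻¹ ^ (l + 1) := by
    rw [inv_pow, ← zpow_natCast, ← zpow_neg]
    congr 1
    push_cast
    ring
  have hbase : 1 + (l : ℝ) * q ≤ (1 + q) * ((l : ℝ) + 1) := by
    nlinarith [Nat.cast_nonneg (α := ℝ) l]
  calc u ^ (-(l : ℤ) - 1) * (1 + (l : ℝ) * q) ^ k
      ≤ u ^ (-(l : ℤ) - 1) * ((1 + q) * ((l : ℝ) + 1)) ^ k := by gcongr
    _ = (1 + q) ^ k * (((l + 1 : ℕ) : ℝ) ^ k * u⁻¹ ^ (l + 1)) := by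
      rw [hzpow, mul_pow]
      push_cast
      ring

theorem add_mul_le_mul_one_add_mul {x y q : ℝ} (hx : 1 ≤ x) (hy : 0 ≤ y) (hq : 0 ≤ q) :
    x + y * q ≤ x * (1 + y * q) := by
  nlinarith [mul_nonneg hy hq]

theorem pow_mul_sub_partial_sum_le {u E : ℝ} (hu : 0 < u) (hE : 0 ≤ E) {m k : ℕ} {β : ℕ → ℝ}
    (hrec : ∀ i : ℕ, 1 ≤ i → u * β i ≤ E * (i : ℝ) ^ k + β (i + m)) {i : ℕ} (hi : 1 ≤ i)
    (r : ℕ) :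
    u ^ r * (β i - E * (∑ l ∈ Finset.range r,
      u ^ (-(l : ℤ) - 1) * (1 + (l : ℝ) * (m : ℝ)) ^ k) * (i : ℝ) ^ k) ≤ β (i + r * m) := by
  induction r with
  | zero => simp
  | succ r ih =>
    have hstep := hrec (i + r * m) (by omega)
    have hbase : ((i + r * m : ℕ) : ℝ) ^ k ≤ ((i : ℝ) * (1 + (r : ℝ) * (m : ℝ))) ^ k := by
      push_cast
      gcongr
      exact add_mul_le_mul_one_add_mul (by exact_mod_cast hi) (by positivity) (by positivity)
    have hmul := mul_le_mul_of_nonneg_left ih hu.le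
    have hE' := mul_le_mul_of_nonneg_left hbase hE
    have hcancel : u ^ (r + 1) * u ^ (-(r : ℤ) - 1) = 1 := by
      rw [← zpow_natCast, ← zpow_add₀ hu.ne']
      simp
    rw [Finset.sum_range_succ, show i + (r + 1) * m = i + r * m + m by ring]
    rw [mul_pow] at hE'
    set S := ∑ l ∈ Finset.range r, u ^ (-(l : ℤ) - 1) * (1 + (l : ℝ) * (m : ℝ)) ^ k
    have hsplit : u ^ (r + 1) * (β i - E * (S + u ^ (-(r : ℤ) - 1) *
        (1 + (r : ℝ) * (m : ℝ)) ^ k) * (i : ℝ) ^ k) =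
        u * (u ^ r * (β i - E * S * (i : ℝ) ^ k)) -
          E * ((i : ℝ) ^ k * (1 + (r : ℝ) * (m : ℝ)) ^ k) := by
      linear_combination (-(E * (i : ℝ) ^ k * (1 + (r : ℝ) * (m : ℝ)) ^ k)) * hcancel
    linarith

theorem nonpos_of_forall_pow_mul_le {u B δ : ℝ} (hu : 1 < u) (hB : 0 ≤ B) {m d i : ℕ}
    (hi : 1 ≤ i)
    (h : ∀ r : ℕ, 1 ≤ r → u ^ r * δ ≤ B * ((i + r * m : ℕ) : ℝ) ^ d) : δ ≤ 0 := by
  have hu0 : 0 < u := by linarith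
  have hlim := ((summable_zpow_neg_mul_affine_pow hu (Nat.cast_nonneg (α := ℝ) m)
    d).tendsto_atTop_zero).const_mul (u * B * (i : ℝ) ^ d)
  rw [mul_zero] at hlim
  refine ge_of_tendsto hlim ?_
  filter_upwards [Filter.eventually_ge_atTop 1] with r hr
  have hbase : ((i + r * m : ℕ) : ℝ) ^ d ≤ ((i : ℝ) * (1 + (r : ℝ) * (m : ℝ))) ^ d := by
    push_cast
    gcongr
    exact add_mul_le_mul_one_add_mul (by exact_mod_cast hi) (by positivity) (by positivity)
  have hle := (h r hr).trans (mul_le_mul_of_nonneg_left hbase hB)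
  have hzpow : u ^ (-(r : ℤ) - 1) = (u ^ r * u)⁻¹ := by
    rw [← pow_succ, ← zpow_natCast, ← zpow_neg]
    congr 1
    push_cast
    ring
  rw [mul_pow] at hle
  rw [hzpow, show u * B * (i : ℝ) ^ d * ((u ^ r * u)⁻¹ * (1 + (r : ℝ) * (m : ℝ)) ^ d) =
    B * ((i : ℝ) ^ d * (1 + (r : ℝ) * (m : ℝ)) ^ d) / u ^ r by field_simp,
    le_div_iff₀ (by positivity)]
  linarith


/-- analytic content of part (iii) of the paper's main technical theorem.
Let `a > b ≥ 1` be integers, `u = a / b > 1`, `n ≥ 0` and `c ≥ 1` integers, `A > 0` real, and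
let `(β i)` be a sequence of nonnegative reals with
`a * β i ≤ A * i ^ (c - 1) + b * β (i + n + 1)` for all `i ≥ 1`.  Then:
(1) the series `C = ∑_{l=0}^{∞} u ^ (-l - 1) * (1 + l * (n + 1)) ^ (c - 1)` converges;
(2) for all `r, i ≥ 1` one has `β (i + r * (n + 1)) ≥ u ^ r * (β i - (A * C / b) * i ^ (c - 1))`;
(3) if `(β i)` is polynomially bounded, then `β i ≤ (A * C / b) * i ^ (c - 1)` for all `i ≥ 1`. -/
theorem stmt8 (a b : ℕ) (hb : 1 ≤ b) (hab : b < a)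
    (u : ℝ) (hu : u = (a : ℝ) / (b : ℝ))
    (n c : ℕ) (hc : 1 ≤ c) (A : ℝ) (hA : 0 < A)
    (β : ℕ → ℝ) (hβ0 : ∀ i, 0 ≤ β i)
    (hrec : ∀ i : ℕ, 1 ≤ i →
      (a : ℝ) * β i ≤ A * (i : ℝ) ^ (c - 1) + (b : ℝ) * β (i + n + 1)) :
    Summable (fun l : ℕ => u ^ (-(l : ℤ) - 1) * (1 + (l : ℝ) * ((n : ℝ) + 1)) ^ (c - 1)) ∧
    (∀ r i : ℕ, 1 ≤ r → 1 ≤ i →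
      u ^ r * (β i -
          A * (∑' l : ℕ, u ^ (-(l : ℤ) - 1) * (1 + (l : ℝ) * ((n : ℝ) + 1)) ^ (c - 1)) /
            (b : ℝ) * (i : ℝ) ^ (c - 1)) ≤
        β (i + r * (n + 1))) ∧
    ((∃ B : ℝ, 0 < B ∧ ∃ d : ℕ, ∀ i : ℕ, 1 ≤ i → β i ≤ B * (i : ℝ) ^ d) →
      ∀ i : ℕ, 1 ≤ i →
        β i ≤ A * (∑' l : ℕ, u ^ (-(l : ℤ) - 1) * (1 + (l : ℝ) * ((n : ℝ) + 1)) ^ (c - 1)) /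
            (b : ℝ) * (i : ℝ) ^ (c - 1)) := by
  have hb0 : (0 : ℝ) < b := by exact_mod_cast hb
  have hu1 : 1 < u := by
    rw [hu, one_lt_div hb0]
    exact_mod_cast hab
  have hu0 : 0 < u := by linarith
  have hE : 0 ≤ A / b := by positivity
  have hsum := summable_zpow_neg_mul_affine_pow hu1 (q := (n : ℝ) + 1) (by positivity) (c - 1)
  have hrec' : ∀ i : ℕ, 1 ≤ i →
      u * β i ≤ A / b * (i : ℝ) ^ (c - 1) + β (i + (n + 1)) := by
    intro i hi
    rw [hu, show (a : ℝ) / b * β i = a * β i / b by ring, div_le_iff₀ hb0, ← add_assoc]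
    refine (hrec i hi).trans_eq ?_
    field_simp
  have hgrowth : ∀ r i : ℕ, 1 ≤ r → 1 ≤ i →
      u ^ r * (β i -
          A * (∑' l : ℕ, u ^ (-(l : ℤ) - 1) * (1 + (l : ℝ) * ((n : ℝ) + 1)) ^ (c - 1)) /
            (b : ℝ) * (i : ℝ) ^ (c - 1)) ≤
        β (i + r * (n + 1)) := by
    intro r i _ hi
    refine le_trans ?_ (pow_mul_sub_partial_sum_le hu0 hE hrec' hi r)
    rw [mul_div_right_comm]
    push_cast
    gcongr
    exact hsum.sum_le_tsum _ (fun l _ => by positivity)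
  refine ⟨hsum, hgrowth, ?_⟩
  rintro ⟨B, hB, d, hpoly⟩ i hi
  exact sub_nonpos.1 (nonpos_of_forall_pow_mul_le hu1 hB.le hi
    fun r hr => (hgrowth r i hr hi).trans (hpoly _ (by omega)))
end
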